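/- Let (V,E,μ) be an infinite, connected, locally finite weighted graph satisfying condition (p₀), let m>1, fix o∈V, and suppose p < 0 and m−1 < q < m (region G₃). If there exist constants C>0 and N∈ℕ such that W_o(n) ≤ C·n^{q/(q−m+1)}·(ln n)^{(m−1)/(q−m+1)} for all n ≥ N, then every positive solution of (★) on V is constant; i.e., (★) admits no nontrivial positive solution. -/

import Mathlib

variable {V : Type*}

/-- Vertex measure `μ(x) = ∑_{y} μ_{xy}` of a weighted graph. -/
noncomputable def vMeasure (μ : V → V → ℝ) (x : V) : ℝ := ∑ᶠ y, μ x y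

/-- The `m`-Laplacian on a weighted graph. -/
noncomputable def lapM (μ : V → V → ℝ) (m : ℝ) (u : V → ℝ) (x : V) : ℝ :=
  (vMeasure μ x)⁻¹ * ∑ᶠ y, μ x y * |u y - u x| ^ (m - 2) * (u y - u x)

/-- The norm of the gradient on a weighted graph. -/
noncomputable def gradNorm (μ : V → V → ℝ) (u : V → ℝ) (x : V) : ℝ :=
  Real.sqrt (∑ᶠ y, μ x y / (2 * vMeasure μ x) * (u y - u x) ^ 2)

open Classical in
/-- `W_o(n)`: the sum of `μ_{xy}` over pairs `(x,y)` with `x ∈ B(o,n)`, `y ∈ V`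
and `d(o,x) < d(o,y)`. -/
noncomputable def Wvol (G : SimpleGraph V) (μ : V → V → ℝ) (o : V) (n : ℕ) : ℝ :=
  ∑ᶠ x, ∑ᶠ y, if G.dist o x ≤ n ∧ G.dist o x < G.dist o y then μ x y else 0

section auxA
open Finset

theorem aux_block (F : ℕ → ℝ) (k0 K : ℕ) (h : k0 ≤ K) :
    ∑ j ∈ Ico (2^k0) (2^K), F j = ∑ k ∈ Ico k0 K, ∑ j ∈ Ico (2^k) (2^(k+1)), F j := by
  induction K, h using Nat.le_induction with
  | base => simp
  | succ n hn ih =>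
    rw [Finset.sum_Ico_succ_top hn, ← ih, Finset.sum_Ico_consecutive]
    · exact Nat.pow_le_pow_right (by norm_num) hn
    · exact Nat.pow_le_pow_right (by norm_num) (by omega)

theorem aux_cap (w : ℕ → ℝ) (hw : ∀ j, 0 ≤ w j) (σ C : ℝ) (hσ : 1 < σ) (hC : 0 < C) (N : ℕ)
    (hW : ∀ n : ℕ, N ≤ n → ∑ j ∈ range (n+1), w j ≤ C * (n:ℝ)^σ * (Real.log n)^(σ-1))
    (r : ℕ) (ε : ℝ) (hε : 0 < ε) :
    ∃ (h : ℕ → ℝ) (M : ℕ), Antitone h ∧ (∀ n, 0 ≤ h n) ∧ (∀ n ≤ r, h n = 1) ∧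
      (∀ n, M ≤ n → h n = 0) ∧ ∑ j ∈ range M, w j * (h j - h (j+1))^σ ≤ ε := by
  set k0 := r + N + 1 with hk0
  have hk0r : r ≤ 2^k0 := by
    have := @Nat.lt_two_pow_self k0; omega
  have hdiv : Filter.Tendsto (fun K : ℕ => ∑ k ∈ range K, (1:ℝ)/((k:ℝ))) Filter.atTop Filter.atTop := by
    exact (not_summable_iff_tendsto_nat_atTop_of_nonneg (fun n => by positivity)).1
      Real.not_summable_one_div_natCast
  have hdiv2 : Filter.Tendsto (fun K : ℕ => (∑ k ∈ range K, (1:ℝ)/((k:ℝ))) - ∑ k ∈ range k0, (1:ℝ)/((k:ℝ)))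
      Filter.atTop Filter.atTop := Filter.tendsto_atTop_add_const_right _ _ hdiv
  have hpow : Filter.Tendsto (fun L : ℝ => C * 2^σ * 2^(σ-1) * L^(-(σ-1))) Filter.atTop (nhds 0) := by
    have := (tendsto_rpow_neg_atTop (y := σ-1) (by linarith)).const_mul (C * 2^σ * 2^(σ-1))
    simpa using this
  have hev : ∀ᶠ L : ℝ in Filter.atTop, C * 2^σ * 2^(σ-1) * L^(-(σ-1)) ≤ ε ∧ 0 < L :=
    (hpow.eventually_le_const hε).and (Filter.eventually_gt_atTop 0)
  obtain ⟨K, ⟨hK1, hK2⟩, hK3⟩ := ((hdiv2.eventually hev).and (Filter.eventually_ge_atTop k0)).exists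
  rw [← Finset.sum_Ico_eq_sub _ hK3] at hK1 hK2
  set L := ∑ k ∈ Ico k0 K, (1:ℝ)/(k:ℝ) with hL
  set a : ℕ → ℝ := fun j => if j < 2^k0 then 0 else 1/((2:ℝ)^(Nat.log 2 j) * (Nat.log 2 j : ℝ)) with ha
  have ha0 : ∀ j, 0 ≤ a j := by
    intro j; simp only [ha]; split_ifs <;> positivity
  have hpp : (2:ℕ)^k0 ≤ 2^K := Nat.pow_le_pow_right (by norm_num) hK3
  have hab : ∀ k, k0 ≤ k → ∀ j ∈ Ico (2^k) (2^(k+1)), a j = 1/((2:ℝ)^k * (k:ℝ)) := by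
    intro k hk j hj
    rw [Finset.mem_Ico] at hj
    have h1 : Nat.log 2 j = k := (Nat.log_eq_iff (Or.inr ⟨by norm_num, by have := Nat.two_pow_pos k; omega⟩)).2 hj
    have h2 : ¬ j < 2^k0 := by
      have : (2:ℕ)^k0 ≤ 2^k := Nat.pow_le_pow_right (by norm_num) hk
      omega
    simp only [ha, h1, if_neg h2]
  have hsum1 : ∑ j ∈ Ico (2^k0) (2^K), a j = L := by
    rw [aux_block _ _ _ hK3, hL]
    apply Finset.sum_congr rfl
    intro k hk
    rw [Finset.mem_Ico] at hk
    rw [Finset.sum_congr rfl (hab k hk.1)]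
    have hkp : (0:ℝ) < k := by exact_mod_cast (by omega : 0 < k)
    have : (2:ℕ)^(k+1) - 2^k = 2^k := by rw [pow_succ]; omega
    simp only [Finset.sum_const, Nat.card_Ico, this, nsmul_eq_mul]
    push_cast
    field_simp
  refine ⟨fun n => (∑ j ∈ Ico n (2^K), a j)/L, 2^K, ?_, ?_, ?_, ?_, ?_⟩
  · intro x y hxy
    apply div_le_div_of_nonneg_right _ hK2.le
    exact Finset.sum_le_sum_of_subset_of_nonneg (Finset.Ico_subset_Ico hxy le_rfl) (fun j _ _ => ha0 j)
  · intro n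
    exact div_nonneg (Finset.sum_nonneg fun j _ => ha0 j) hK2.le
  · intro n hn
    have h0 : ∑ j ∈ Ico n (2^k0), a j = 0 := by
      apply Finset.sum_eq_zero
      intro j hj
      rw [Finset.mem_Ico] at hj
      simp only [ha, if_pos hj.2]
    show (∑ j ∈ Ico n (2^K), a j)/L = 1
    rw [← Finset.sum_Ico_consecutive _ (hn.trans hk0r) hpp, h0, hsum1, zero_add, div_self hK2.ne']
  · intro n hn
    show (∑ j ∈ Ico n (2^K), a j)/L = 0
    rw [Finset.Ico_eq_empty (by omega)]; simp
  · have hdiff : ∀ j ∈ range (2^K), w j * ((∑ i ∈ Ico j (2^K), a i)/L - (∑ i ∈ Ico (j+1) (2^K), a i)/L)^σ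
        = w j * (a j / L)^σ := by
      intro j hj
      rw [Finset.mem_range] at hj
      rw [Finset.sum_eq_sum_Ico_succ_bot hj]
      congr 2
      ring
    show ∑ j ∈ range (2^K), w j * ((∑ i ∈ Ico j (2^K), a i)/L - (∑ i ∈ Ico (j+1) (2^K), a i)/L)^σ ≤ ε
    rw [Finset.sum_congr rfl hdiff, Finset.range_eq_Ico,
      ← Finset.sum_Ico_consecutive _ (Nat.zero_le (2^k0)) hpp]
    have h0 : ∑ j ∈ Ico 0 (2^k0), w j * (a j / L)^σ = 0 := by
      apply Finset.sum_eq_zero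
      intro j hj
      rw [Finset.mem_Ico] at hj
      simp only [ha, if_pos hj.2, zero_div]
      rw [Real.zero_rpow (by linarith), mul_zero]
    rw [h0, zero_add, aux_block _ _ _ hK3]
    have hblk : ∀ k ∈ Ico k0 K, ∑ j ∈ Ico (2^k) (2^(k+1)), w j * (a j / L)^σ ≤
        (C * 2^σ * 2^(σ-1) * L^(-σ)) * (1/(k:ℝ)) := by
      intro k hk
      rw [Finset.mem_Ico] at hk
      have hkp : (0:ℝ) < k := by exact_mod_cast (by omega : 0 < k)
      have hk1 : (1:ℝ) ≤ k := by exact_mod_cast (by omega : 1 ≤ k)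
      rw [Finset.sum_congr rfl (fun j hj => by rw [hab k hk.1 j hj]), ← Finset.sum_mul]
      have hs : ∑ j ∈ Ico (2^k) (2^(k+1)), w j ≤ C * (2 * 2^k)^σ * (2 * k)^(σ-1) := by
        have hN : N ≤ 2^(k+1) := by
          have := @Nat.lt_two_pow_self (k+1); omega
        refine le_trans ?_ ((hW _ hN).trans ?_)
        · apply Finset.sum_le_sum_of_subset_of_nonneg
          · intro j hj
            rw [Finset.mem_Ico] at hj
            rw [Finset.mem_range]; omega
          · intro j _ _; exact hw j
        · have e : (((2^(k+1) : ℕ)):ℝ) = 2 * 2^k := by push_cast; ring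
          have e2 : Real.log (((2^(k+1) : ℕ)):ℝ) ≤ 2 * k := by
            push_cast
            rw [Real.log_pow]
            have := Real.log_two_lt_d9
            push_cast
            nlinarith
          have e3 : 0 ≤ Real.log (((2^(k+1) : ℕ)):ℝ) := Real.log_natCast_nonneg _
          have := Real.rpow_le_rpow e3 e2 (by linarith : 0 ≤ σ - 1)
          rw [← e]
          gcongr
      calc _ ≤ (C * (2 * 2^k)^σ * (2 * k)^(σ-1)) * (1/((2:ℝ)^k * (k:ℝ))/L)^σ := by
            gcongr
        _ = _ := by
          have e1 : (1/((2:ℝ)^k * (k:ℝ))/L)^σ = ((2:ℝ)^k)^(-σ) * (k:ℝ)^(-σ) * L^(-σ) := by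
            rw [show (1/((2:ℝ)^k * (k:ℝ))/L) = ((2:ℝ)^k * k * L)⁻¹ by field_simp,
              Real.inv_rpow (by positivity), ← Real.rpow_neg (by positivity),
              Real.mul_rpow (by positivity) hK2.le, Real.mul_rpow (by positivity) hkp.le]
          have e2 : (1/(k:ℝ)) = (k:ℝ)^(σ-1) * (k:ℝ)^(-σ) := by
            rw [← Real.rpow_add hkp]; ring_nf
            rw [Real.rpow_neg_one]
          have e3 : ((2:ℝ)^k)^σ * ((2:ℝ)^k)^(-σ) = 1 := by
            rw [← Real.rpow_add (by positivity)]; simp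
          rw [e1, e2, Real.mul_rpow (by norm_num) (by positivity), Real.mul_rpow (by norm_num) hkp.le]
          linear_combination (C * 2^σ * 2^(σ-1) * (k:ℝ)^(σ-1) * (k:ℝ)^(-σ) * L^(-σ)) * e3
    refine (Finset.sum_le_sum hblk).trans ?_
    rw [← Finset.mul_sum, ← hL]
    refine le_trans (le_of_eq ?_) hK1
    rw [show -(σ-1) = -σ + 1 by ring, Real.rpow_add hK2, Real.rpow_one]
    ring

/-- edgewise Young inequality -/
theorem aux_young (m q σ δ : ℝ) (hm : 1 < m) (hq1 : m - 1 < q) (hσ : σ = q / (q - m + 1)) (hδ : 0 < δ) :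
    ∃ D : ℝ, 0 < D ∧ ∀ a b c : ℝ, 0 ≤ a → 0 ≤ b → 0 ≤ c → c ≤ b →
      a^(m-1) * (b^σ - c^σ) ≤ δ * a^q * b^σ + D * (b - c)^σ := by
  have hm1 : 0 < m - 1 := by linarith
  have hqm : 0 < q - m + 1 := by linarith
  have hq : 0 < q := by linarith
  have hσ1 : 1 < σ := by rw [hσ, lt_div_iff₀ hqm]; linarith
  set τ := q/(m-1) with hτ
  have hτ0 : 0 < τ := by positivity
  have hconj : τ.HolderConjugate σ := by
    rw [Real.holderConjugate_iff]
    refine ⟨by rw [hτ, lt_div_iff₀ hm1]; linarith, ?_⟩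
    rw [hτ, hσ]; field_simp; ring
  refine ⟨(σ * δ^(-(1/τ)))^σ, by positivity, ?_⟩
  intro a b c ha hb hc hcb
  have hbern : b^σ - c^σ ≤ σ * b^(σ-1) * (b - c) := by
    rcases hb.eq_or_lt with rfl | hb'
    · have : c = 0 := le_antisymm hcb hc
      simp [this]
    · have h1 := one_add_mul_self_le_rpow_one_add (s := c/b - 1) (p := σ)
        (by have : 0 ≤ c/b := by positivity
            linarith) hσ1.le
      rw [show 1 + (c/b - 1) = c/b by ring, Real.div_rpow hc hb] at h1
      have hbs : 0 < b^σ := by positivity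
      rw [le_div_iff₀ hbs] at h1
      have e : b^σ = b^(σ-1) * b := by
        rw [← Real.rpow_add_one hb'.ne']; ring_nf
      have : (c/b - 1) * b = c - b := by field_simp
      have e2 : (1 + σ*(c/b-1)) * b^σ = b^σ + σ * b^(σ-1) * (c - b) := by
        rw [← this]; linear_combination (σ*(c/b-1)) * e
      rw [e2] at h1
      linarith
  have hP : (a^(m-1) * b^(σ-1))^τ = a^q * b^σ := by
    rw [Real.mul_rpow (by positivity) (by positivity), ← Real.rpow_mul ha, ← Real.rpow_mul hb]
    congr 2
    · rw [hτ]; field_simp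
    · rw [hτ, hσ]; field_simp; ring
  have hbc : 0 ≤ b - c := by linarith
  have hy := Real.young_inequality_of_nonneg (a := δ^(1/τ) * (a^(m-1) * b^(σ-1)))
    (b := (σ * δ^(-(1/τ))) * (b - c)) (by positivity) (by positivity) hconj
  rw [Real.mul_rpow (by positivity) (by positivity), hP, Real.mul_rpow (by positivity) hbc,
    ← Real.rpow_mul hδ.le, one_div_mul_cancel hτ0.ne', Real.rpow_one] at hy
  have hd : δ^(1/τ) * δ^(-(1/τ)) = 1 := by
    rw [← Real.rpow_add hδ]; simp
  have h1 : δ * (a^q * b^σ) / τ ≤ δ * (a^q * b^σ) := div_le_self (by positivity) hconj.lt.le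
  have h2 : (σ * δ^(-(1/τ)))^σ * (b-c)^σ / σ ≤ (σ * δ^(-(1/τ)))^σ * (b-c)^σ :=
    div_le_self (by positivity) hσ1.le
  calc a^(m-1) * (b^σ - c^σ) ≤ a^(m-1) * (σ * b^(σ-1) * (b - c)) := by gcongr
    _ = δ^(1/τ) * (a^(m-1) * b^(σ-1)) * ((σ * δ^(-(1/τ))) * (b - c)) := by
      linear_combination (-(a^(m-1) * b^(σ-1) * σ * (b-c))) * hd
    _ ≤ _ := by linarith

end auxA

theorem aux_J (m t : ℝ) (hm : 1 < m) : |(|t|^(m-2) * t)| = |t|^(m-1) := by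
  rcases eq_or_ne t 0 with rfl | ht
  · simp [Real.zero_rpow (by linarith : m - 1 ≠ 0)]
  · have : 0 < |t| := abs_pos.2 ht
    rw [abs_mul, abs_of_nonneg (by positivity : 0 ≤ |t|^(m-2)), ← Real.rpow_add_one this.ne']
    ring_nf

theorem aux_edge (m k s t e1 e2 : ℝ) (hm : 1 < m) (h12 : e2 ≤ e1) (h2 : 0 ≤ e2) :
    |t - s|^(m-2) * (t - s) * (e2 * max (k - t) 0 - e1 * max (k - s) 0) ≤
      max (k - s) 0 * (|t - s|^(m-1) * (e1 - e2)) := by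
  have hJ := aux_J m (t - s) hm
  set J := |t - s|^(m-2) * (t - s) with hJd
  have h1 : J * (max (k - t) 0 - max (k - s) 0) ≤ 0 := by
    have hp : 0 ≤ |t-s|^(m-2) := by positivity
    rcases le_total s t with h | h
    · apply mul_nonpos_of_nonneg_of_nonpos
      · exact mul_nonneg hp (by linarith)
      · have : max (k - t) 0 ≤ max (k - s) 0 := max_le_max_right _ (by linarith)
        linarith
    · apply mul_nonpos_of_nonpos_of_nonneg
      · exact mul_nonpos_of_nonneg_of_nonpos hp (by linarith)
      · have : max (k - s) 0 ≤ max (k - t) 0 := max_le_max_right _ (by linarith)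
        linarith
  have h3 : -J ≤ |t-s|^(m-1) := by rw [← hJ]; exact neg_le_abs J
  have hf : 0 ≤ max (k - s) 0 := le_max_right _ _
  have h4 : max (k-s) 0 * (e1 - e2) * (-J) ≤ max (k-s) 0 * (e1 - e2) * |t-s|^(m-1) :=
    mul_le_mul_of_nonneg_left h3 (mul_nonneg hf (by linarith))
  have h5 := mul_nonpos_of_nonneg_of_nonpos h2 h1
  nlinarith

theorem aux_energy (T : Finset V) (μ : V → V → ℝ) (hsymm : ∀ x y, μ x y = μ y x)
    (hnonneg : ∀ x y, 0 ≤ μ x y) (d : V → ℕ) (u : V → ℝ) (m k : ℝ) (hm : 1 < m)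
    (g : ℕ → ℝ) (hg : Antitone g) (hg0 : ∀ n, 0 ≤ g n) :
    - ∑ x ∈ T, ∑ y ∈ T, (g (d x) * max (k - u x) 0) * (μ x y * |u y - u x|^(m-2) * (u y - u x)) ≤
      ∑ x ∈ T, ∑ y ∈ T, if d x < d y then
        μ x y * (max (k - u x) 0 * (|u y - u x|^(m-1) * (g (d x) - g (d y)))) else 0 := by
  set A : V → V → ℝ := fun x y =>
    (g (d x) * max (k - u x) 0) * (μ x y * |u y - u x|^(m-2) * (u y - u x)) with hA
  set R : V → V → ℝ := fun x y => if d x < d y then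
        μ x y * (max (k - u x) 0 * (|u y - u x|^(m-1) * (g (d x) - g (d y)))) else 0 with hR
  have key1 : ∀ x y, d x ≤ d y → - A x y - A y x ≤ μ x y * (max (k - u x) 0 * (|u y - u x|^(m-1) * (g (d x) - g (d y)))) := by
    intro x y hxy
    have := aux_edge m k (u x) (u y) (g (d x)) (g (d y)) hm (hg hxy) (hg0 _)
    have := mul_le_mul_of_nonneg_left this (hnonneg x y)
    refine le_trans (le_of_eq ?_) this
    simp only [hA]
    rw [hsymm y x, abs_sub_comm (u x) (u y)]
    ring
  have key2 : ∀ x y, d x ≤ d y → - A x y - A y x ≤ R x y := by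
    intro x y hxy
    refine (key1 x y hxy).trans ?_
    simp only [hR]
    rcases hxy.eq_or_lt with h | h
    · simp [h]
    · simp [h]
  have hR0 : ∀ x y, 0 ≤ R x y := by
    intro x y
    simp only [hR]
    split_ifs with h
    · have := hg h.le
      have h1 : 0 ≤ g (d x) - g (d y) := by linarith
      have := hnonneg x y
      have : 0 ≤ max (k - u x) 0 := le_max_right _ _
      positivity
    · exact le_rfl
  have key : ∀ x y, - A x y - A y x ≤ R x y + R y x := by
    intro x y
    rcases le_total (d x) (d y) with h | h
    · linarith [key2 x y h, hR0 y x]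
    · linarith [key2 y x h, hR0 x y]
  have hsum := Finset.sum_le_sum (fun x (_ : x ∈ T) => Finset.sum_le_sum (fun y (_ : y ∈ T) => key x y))
  simp only [Finset.sum_sub_distrib, Finset.sum_add_distrib, Finset.sum_neg_distrib] at hsum
  rw [Finset.sum_comm (f := fun x y => A y x), Finset.sum_comm (f := fun x y => R y x)] at hsum
  linarith

theorem aux_adj_dist (G : SimpleGraph V) (hconn : G.Connected) (o : V) {x y : V} (h : G.Adj x y) :
    G.dist o y ≤ G.dist o x + 1 := by
  have := hconn.dist_triangle (u := o) (v := x) (w := y)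
  rwa [SimpleGraph.dist_eq_one_iff_adj.2 h] at this

theorem aux_ball (G : SimpleGraph V) (hconn : G.Connected) (hlf : ∀ x, (G.neighborSet x).Finite)
    (o : V) (n : ℕ) : {x | G.dist o x ≤ n}.Finite := by
  induction n with
  | zero =>
    apply (Set.finite_singleton o).subset
    intro x hx
    have : G.dist o x = 0 := by simpa using hx
    exact ((hconn.dist_eq_zero_iff).1 this).symm
  | succ n ih =>
    apply (ih.union (ih.biUnion (fun x _ => hlf x))).subset
    intro x hx
    by_cases h : G.dist o x ≤ n
    · exact Or.inl h
    · right
      have hx' : G.dist o x = n + 1 := le_antisymm hx (by omega)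
      obtain ⟨p, hp⟩ := hconn.exists_walk_length_eq_dist x o
      rw [SimpleGraph.dist_comm, hx'] at hp
      cases p with
      | nil => simp at hp
      | @cons _ v _ hadj p =>
        simp only [SimpleGraph.Walk.length_cons] at hp
        simp only [Set.mem_iUnion]
        refine ⟨v, ?_, hadj.symm⟩
        have := SimpleGraph.dist_le p
        rw [SimpleGraph.dist_comm] at this
        show G.dist o v ≤ n
        omega

theorem aux_dbl (G : SimpleGraph V) (μ : V → V → ℝ) (hnonneg : ∀ x y, 0 ≤ μ x y)
    (hadj : ∀ x y, 0 < μ x y ↔ G.Adj x y) (hconn : G.Connected) (o : V) (n : ℕ)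
    (T : Finset V) (hT : ∀ x, x ∈ T ↔ G.dist o x ≤ n + 1) (P : V → V → Prop) [∀ x y, Decidable (P x y)]
    (hP : ∀ x y, P x y → G.dist o x ≤ n) :
    (∑ᶠ x, ∑ᶠ y, if P x y then μ x y else 0) = ∑ x ∈ T, ∑ y ∈ T, if P x y then μ x y else 0 := by
  have hin : ∀ x, (∑ᶠ y, if P x y then μ x y else 0) = ∑ y ∈ T, if P x y then μ x y else 0 := by
    intro x
    apply finsum_eq_sum_of_support_subset
    intro y hy
    rw [Function.mem_support] at hy
    split_ifs at hy with h
    · have h1 := hP x y h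
      have h2 := (hadj x y).1 (lt_of_le_of_ne (hnonneg x y) (Ne.symm hy))
      have h3 := aux_adj_dist G hconn o h2
      exact (hT y).2 (by omega)
    · exact absurd rfl hy
  simp only [hin]
  apply finsum_eq_sum_of_support_subset
  intro x hx
  rw [Function.mem_support] at hx
  obtain ⟨y, -, hy⟩ := Finset.exists_ne_zero_of_sum_ne_zero hx
  split_ifs at hy with h
  · have h1 := hP x y h
    exact (hT x).2 (by omega)
  · exact absurd rfl hy

theorem aux_wsum (G : SimpleGraph V) (μ : V → V → ℝ) (hnonneg : ∀ x y, 0 ≤ μ x y)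
    (hadj : ∀ x y, 0 < μ x y ↔ G.Adj x y) (hconn : G.Connected)
    (hlf : ∀ x, (G.neighborSet x).Finite) (o : V) :
    ∃ w : ℕ → ℝ, (∀ j, 0 ≤ w j) ∧ (∀ n, ∑ j ∈ Finset.range (n+1), w j = Wvol G μ o n) ∧
      ∀ (M : ℕ) (T : Finset V), (∀ x, x ∈ T ↔ G.dist o x ≤ M) → ∀ c : ℕ → ℝ,
        (∑ x ∈ T, ∑ y ∈ T, if G.dist o x < G.dist o y then μ x y * c (G.dist o x) else 0)
          = ∑ j ∈ Finset.range M, w j * c j := by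
  classical
  have hmain : ∀ (M : ℕ) (T : Finset V), (∀ x, x ∈ T ↔ G.dist o x ≤ M) → ∀ j < M,
      (∑ᶠ x, ∑ᶠ y, if G.dist o x = j ∧ G.dist o x < G.dist o y then μ x y else 0) =
      ∑ x ∈ T, ∑ y ∈ T, if G.dist o x = j ∧ G.dist o x < G.dist o y then μ x y else 0 := by
    intro M T hT j hj
    obtain ⟨n, rfl⟩ : ∃ n, M = n + 1 := ⟨M - 1, by omega⟩
    exact aux_dbl G μ hnonneg hadj hconn o n T hT
      (fun x y => G.dist o x = j ∧ G.dist o x < G.dist o y) (fun x y h => by omega)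
  have h3 : ∀ (M : ℕ) (T : Finset V), (∀ x, x ∈ T ↔ G.dist o x ≤ M) → ∀ c : ℕ → ℝ,
        (∑ x ∈ T, ∑ y ∈ T, if G.dist o x < G.dist o y then μ x y * c (G.dist o x) else 0)
          = ∑ j ∈ Finset.range M, (∑ᶠ x, ∑ᶠ y, if G.dist o x = j ∧ G.dist o x < G.dist o y then μ x y else 0) * c j := by
    intro M T hT c
    have e : ∀ j ∈ Finset.range M, (∑ᶠ x, ∑ᶠ y, if G.dist o x = j ∧ G.dist o x < G.dist o y then μ x y else 0) * c j
        = (∑ x ∈ T, ∑ y ∈ T, if G.dist o x = j ∧ G.dist o x < G.dist o y then μ x y else 0) * c j := by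
      intro j hj
      rw [hmain M T hT j (Finset.mem_range.1 hj)]
    rw [Finset.sum_congr rfl e]
    simp only [Finset.sum_mul]
    refine Eq.trans ?_ Finset.sum_comm
    apply Finset.sum_congr rfl
    intro x hx
    refine Eq.trans ?_ Finset.sum_comm
    apply Finset.sum_congr rfl
    intro y hy
    have hy' := (hT y).1 hy
    by_cases h : G.dist o x < G.dist o y
    · rw [Finset.sum_eq_single_of_mem (G.dist o x) (Finset.mem_range.2 (by omega))]
      · simp [h]
      · intro b _ hb
        simp [hb.symm]
    · simp [h]
  refine ⟨fun j => ∑ᶠ x, ∑ᶠ y, if G.dist o x = j ∧ G.dist o x < G.dist o y then μ x y else 0, ?_, ?_, h3⟩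
  · intro j
    refine finsum_nonneg fun x => finsum_nonneg fun y => ?_
    split_ifs
    · exact hnonneg x y
    · exact le_rfl
  · intro n
    have hfin := aux_ball G hconn hlf o (n+1)
    have hT : ∀ x, x ∈ hfin.toFinset ↔ G.dist o x ≤ n + 1 := by intro x; simp
    have := h3 (n+1) hfin.toFinset hT (fun _ => 1)
    simp only [mul_one] at this
    rw [← this]
    unfold Wvol
    have h4 := aux_dbl G μ hnonneg hadj hconn o n hfin.toFinset hT
      (fun x y => G.dist o x ≤ n ∧ G.dist o x < G.dist o y) (fun x y h => h.1)
    refine Eq.trans ?_ (Eq.trans h4.symm ?_)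
    rotate_left
    · refine finsum_congr fun x => finsum_congr fun y => ?_
      congr
    apply Finset.sum_congr rfl
    intro x hx
    apply Finset.sum_congr rfl
    intro y hy
    have := (hT y).1 hy
    by_cases h : G.dist o x < G.dist o y
    · have : G.dist o x ≤ n := by omega
      simp [h, this]
    · simp [h]

theorem statement6
    (G : SimpleGraph V) (μ : V → V → ℝ)
    (hsymm : ∀ x y, μ x y = μ y x)
    (hnonneg : ∀ x y, 0 ≤ μ x y)
    (hadj : ∀ x y, 0 < μ x y ↔ G.Adj x y)
    (hinf : Infinite V) (hconn : G.Connected)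
    (hlf : ∀ x, (G.neighborSet x).Finite)
    (p₀ : ℝ) (hp₀ : 1 < p₀)
    (hcond : ∀ x y, G.Adj x y → 1 / p₀ ≤ μ x y / vMeasure μ x)
    (m p q : ℝ) (hm : 1 < m)
    (hp : p < 0) (hq1 : m - 1 < q) (hq2 : q < m)
    (o : V) (C : ℝ) (hC : 0 < C) (N : ℕ)
    (hW : ∀ n : ℕ, N ≤ n →
      Wvol G μ o n ≤
        C * (n : ℝ) ^ (q / (q - m + 1)) *
          (Real.log n) ^ ((m - 1) / (q - m + 1)))
    (u : V → ℝ) (hu : ∀ x, 0 < u x)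
    (hgrad : ∀ x, q < 0 → 0 < gradNorm μ u x)
    (hsol : ∀ x, lapM μ m u x + u x ^ p * gradNorm μ u x ^ q ≤ 0) :
    ∃ c : ℝ, ∀ x, u x = c := by
  have hm1 : 0 < m - 1 := by linarith
  have hqm : 0 < q - m + 1 := by linarith
  have hq : 0 < q := by linarith
  obtain ⟨σ, hσ⟩ : ∃ σ, σ = q / (q - m + 1) := ⟨_, rfl⟩
  have hσ1 : 1 < σ := by rw [hσ, lt_div_iff₀ hqm]; linarith
  have hσ2 : (m - 1) / (q - m + 1) = σ - 1 := by rw [hσ]; field_simp; ring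
  rw [← hσ, hσ2] at hW
  have hp0 : 0 < p₀ := by linarith
  obtain ⟨w, hw0, hwW, hwc⟩ := aux_wsum G μ hnonneg hadj hconn hlf o
  -- supports
  have hsupp : ∀ x y, μ x y ≠ 0 → G.Adj x y := fun x y h =>
    (hadj x y).1 (lt_of_le_of_ne (hnonneg x y) (Ne.symm h))
  have hfs : ∀ (x : V) (F : V → ℝ), (Function.support fun y => μ x y * F y).Finite := by
    intro x F
    apply (hlf x).subset
    intro y hy
    rw [Function.mem_support] at hy
    exact hsupp x y (left_ne_zero_of_mul hy)
  have hvm0 : ∀ x, 0 ≤ vMeasure μ x := fun x => finsum_nonneg fun y => hnonneg x y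
  have hvle : ∀ x y, μ x y ≤ vMeasure μ x := by
    intro x y
    unfold vMeasure
    apply single_le_finsum y (by have := hfs x (fun _ => 1); simp only [mul_one] at this; exact this) (fun y => hnonneg x y)
  have hvpos : ∀ x y, G.Adj x y → 0 < vMeasure μ x := fun x y h =>
    lt_of_lt_of_le ((hadj x y).2 h) (hvle x y)
  -- gradient controls differences
  have hgr0 : ∀ x, 0 ≤ gradNorm μ u x := fun x => Real.sqrt_nonneg _
  have hgr : ∀ x y, G.Adj x y → |u y - u x| ≤ Real.sqrt (2 * p₀) * gradNorm μ u x := by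
    intro x y h
    unfold gradNorm
    rw [← Real.sqrt_mul (by positivity), ← Real.sqrt_sq_eq_abs]
    apply Real.sqrt_le_sqrt
    have h1 : μ x y / (2 * vMeasure μ x) * (u y - u x) ^ 2 ≤
        ∑ᶠ y, μ x y / (2 * vMeasure μ x) * (u y - u x) ^ 2 := by
      apply single_le_finsum (f := fun y => μ x y / (2 * vMeasure μ x) * (u y - u x) ^ 2) y
      · have := hfs x (fun y => (1 / (2 * vMeasure μ x)) * (u y - u x) ^ 2)
        refine this.subset (le_of_eq ?_)
        congr 1
        funext y
        ring
      · intro z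
        have := hvm0 x
        have := hnonneg x z
        positivity
    have h2 := hcond x y h
    have hv := hvpos x y h
    have h3 : 1 / (2 * p₀) * (u y - u x)^2 ≤ μ x y / (2 * vMeasure μ x) * (u y - u x) ^ 2 := by
      apply mul_le_mul_of_nonneg_right _ (sq_nonneg _)
      calc 1 / (2 * p₀) = (1 / p₀) / 2 := by field_simp
        _ ≤ (μ x y / vMeasure μ x) / 2 := by linarith
        _ = _ := by field_simp
    calc (u y - u x)^2 = (2 * p₀) * (1 / (2 * p₀) * (u y - u x)^2) := by field_simp
      _ ≤ _ := mul_le_mul_of_nonneg_left (h3.trans h1) (by positivity)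
  -- reduction
  suffices hz : ∀ x, gradNorm μ u x = 0 by
    refine ⟨u o, fun x => ?_⟩
    have hst : ∀ x y, G.Adj x y → u y = u x := by
      intro x y h
      have := hgr x y h
      rw [hz x, mul_zero] at this
      have := abs_nonpos_iff.1 this
      linarith
    obtain ⟨W⟩ := hconn.preconnected x o
    clear hW hwW hwc
    induction W with
    | nil => rfl
    | cons h _ ih => rw [← hst _ _ h]; exact ih
  intro x0
  by_contra hne
  have hgpos : 0 < gradNorm μ u x0 := lt_of_le_of_ne (hgr0 x0) (Ne.symm hne)
  obtain ⟨z, hz⟩ : ∃ z, G.Adj x0 z := by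
    by_contra hcon
    push Not at hcon
    apply hne
    unfold gradNorm
    have : ∀ y, μ x0 y = 0 := fun y => by
      by_contra h
      exact hcon y (hsupp _ _ h)
    simp [this]
  have hv0 := hvpos x0 z hz
  obtain ⟨k, hk⟩ : ∃ k, k = u x0 + 1 := ⟨_, rfl⟩
  have hkpos : 0 < k := by have := hu x0; linarith
  have hkp : 0 < k ^ p := Real.rpow_pos_of_pos hkpos p
  obtain ⟨A, hA⟩ : ∃ A, A = (Real.sqrt (2 * p₀)) ^ q := ⟨_, rfl⟩
  have hApos : 0 < A := by rw [hA]; positivity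
  obtain ⟨D, hD, hyoung⟩ := aux_young m q σ (k ^ p / (2 * A)) hm hq1 hσ (by positivity)
  -- the key estimate
  have hkey : ∀ ε : ℝ, 0 < ε →
      vMeasure μ x0 * gradNorm μ u x0 ^ q * (k ^ p / 2) ≤ D * k * ε := by
    intro ε hε
    obtain ⟨h, M, hanti, h0, h1, hM, hcap⟩ := aux_cap w hw0 σ C hσ1 hC N
      (fun n hn => by rw [hwW]; exact hW n hn) (G.dist o x0) ε hε
    obtain ⟨T, hT⟩ : ∃ T : Finset V, ∀ x, x ∈ T ↔ G.dist o x ≤ M :=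
      ⟨(aux_ball G hconn hlf o M).toFinset, fun x => by simp⟩
    obtain ⟨d, hd⟩ : ∃ d : V → ℕ, d = fun x => G.dist o x := ⟨_, rfl⟩
    have hdx : ∀ x, G.dist o x = d x := fun x => by rw [hd]
    simp only [hdx] at hT h1 hwc
    obtain ⟨g, hg⟩ : ∃ g : ℕ → ℝ, g = fun n => h n ^ σ := ⟨_, rfl⟩
    have hg0 : ∀ n, 0 ≤ g n := fun n => by rw [hg]; exact Real.rpow_nonneg (h0 n) σ
    have hganti : Antitone g := by
      intro a b hab
      rw [hg]
      exact Real.rpow_le_rpow (h0 b) (hanti hab) (by linarith)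
    have hgM : ∀ n, M ≤ n → g n = 0 := by
      intro n hn
      rw [hg]
      show h n ^ σ = 0
      rw [hM n hn, Real.zero_rpow (by linarith)]
    have hfsum : ∀ x, d x < M → ∀ F : V → ℝ, ∑ᶠ y, μ x y * F y = ∑ y ∈ T, μ x y * F y := by
      intro x hx F
      apply finsum_eq_sum_of_support_subset
      intro y hy
      rw [Function.mem_support] at hy
      have := aux_adj_dist G hconn o (hsupp x y (left_ne_zero_of_mul hy))
      rw [hdx, hdx] at this
      exact (hT y).2 (by omega)
    have hvsum : ∀ x, d x < M → vMeasure μ x = ∑ y ∈ T, μ x y := by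
      intro x hx
      have := hfsum x hx (fun _ => 1)
      simpa [vMeasure] using this
    have hen := aux_energy T μ hsymm hnonneg d u m k hm g hganti hg0
    obtain ⟨X, hX⟩ : ∃ X, X = ∑ x ∈ T, g (d x) * max (k - u x) 0 *
      (vMeasure μ x * gradNorm μ u x ^ q) := ⟨_, rfl⟩
    have hf0 : ∀ x, 0 ≤ max (k - u x) 0 := fun x => le_max_right _ _
    have hfk : ∀ x, max (k - u x) 0 ≤ k := fun x => max_le (by linarith [hu x]) hkpos.le
    have hgq0 : ∀ x, 0 ≤ gradNorm μ u x ^ q := fun x => Real.rpow_nonneg (hgr0 x) q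
    -- lower bound
    have hlow : k ^ p * X ≤ - ∑ x ∈ T, ∑ y ∈ T,
        (g (d x) * max (k - u x) 0) * (μ x y * |u y - u x|^(m-2) * (u y - u x)) := by
      rw [hX, Finset.mul_sum, ← Finset.sum_neg_distrib]
      apply Finset.sum_le_sum
      intro x hx
      rw [← Finset.mul_sum]
      rcases Nat.lt_or_ge (d x) M with hxM | hxM
      swap
      · simp [hgM _ hxM]
      rcases le_or_gt k (u x) with hux | hux
      · rw [max_eq_right (by linarith)]; simp
      have hs := hsol x
      have hup : k ^ p ≤ u x ^ p := Real.rpow_le_rpow_of_nonpos (hu x) hux.le hp.le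
      have hE : ∑ᶠ y, μ x y * |u y - u x| ^ (m - 2) * (u y - u x) =
          ∑ y ∈ T, μ x y * |u y - u x| ^ (m - 2) * (u y - u x) := by
        have := hfsum x hxM (fun y => |u y - u x| ^ (m - 2) * (u y - u x))
        simpa only [mul_assoc] using this
      unfold lapM at hs
      rw [hE] at hs
      set E := ∑ y ∈ T, μ x y * |u y - u x| ^ (m - 2) * (u y - u x) with hEd
      have hmul : k ^ p * (vMeasure μ x * gradNorm μ u x ^ q) ≤ - E := by
        rcases (hvm0 x).eq_or_lt with hv | hv
        · have hz : ∀ y, μ x y = 0 := fun y => le_antisymm (hv ▸ hvle x y) (hnonneg x y)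
          have : E = 0 := by rw [hEd]; simp [hz]
          rw [this, ← hv]; simp
        · have h5 := mul_le_mul_of_nonneg_left hs hv.le
          rw [mul_zero, mul_add, ← mul_assoc, mul_inv_cancel₀ hv.ne', one_mul] at h5
          have h6 : k ^ p * (vMeasure μ x * gradNorm μ u x ^ q) ≤
            u x ^ p * (vMeasure μ x * gradNorm μ u x ^ q) :=
            mul_le_mul_of_nonneg_right hup (mul_nonneg hv.le (hgq0 x))
          linarith
      have := mul_le_mul_of_nonneg_left hmul (mul_nonneg (hg0 (d x)) (hf0 x))
      linarith
    -- upper bound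
    have hup : (∑ x ∈ T, ∑ y ∈ T, if d x < d y then
        μ x y * (max (k - u x) 0 * (|u y - u x|^(m-1) * (g (d x) - g (d y)))) else 0) ≤
        k ^ p / 2 * X + D * k * ε := by
      have hpt : ∀ x ∈ T, ∀ y ∈ T, (if d x < d y then
        μ x y * (max (k - u x) 0 * (|u y - u x|^(m-1) * (g (d x) - g (d y)))) else 0) ≤
          (k ^ p / (2 * A)) * (g (d x) * max (k - u x) 0) * (μ x y * |u y - u x| ^ q) +
          D * k * (if d x < d y then μ x y * (h (d x) - h (d x + 1)) ^ σ else 0) := by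
        intro x _ y _
        have hB : 0 ≤ (k ^ p / (2 * A)) * (g (d x) * max (k - u x) 0) * (μ x y * |u y - u x| ^ q) := by
          have := hg0 (d x)
          have := hf0 x
          have := hnonneg x y
          positivity
        split_ifs with hxy
        swap
        · simpa using hB
        by_cases hμ : μ x y = 0
        · simp [hμ]
        have h7 := aux_adj_dist G hconn o (hsupp x y hμ)
        rw [hdx, hdx] at h7
        have h8 : d y = d x + 1 := by omega
        rw [h8]
        have hy := hyoung |u y - u x| (h (d x)) (h (d x + 1)) (abs_nonneg _) (h0 _) (h0 _)
          (hanti (Nat.le_succ _))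
        have hgg : ∀ n, g n = h n ^ σ := fun n => by rw [hg]
        rw [← hgg, ← hgg] at hy
        have hdd : 0 ≤ (h (d x) - h (d x + 1)) ^ σ :=
          Real.rpow_nonneg (by linarith [hanti (Nat.le_succ (d x))]) σ
        have h9 := mul_le_mul_of_nonneg_left (mul_le_mul_of_nonneg_left hy (hf0 x)) (hnonneg x y)
        have h10 := mul_le_mul_of_nonneg_right (hfk x)
          (mul_nonneg (mul_nonneg hD.le (hnonneg x y)) hdd)
        linarith
      refine (Finset.sum_le_sum fun x hx => Finset.sum_le_sum fun y hy => hpt x hx y hy).trans ?_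
      simp only [Finset.sum_add_distrib, ← Finset.mul_sum]
      rw [hwc M T hT (fun j => (h j - h (j+1)) ^ σ)]
      apply add_le_add
      · rw [hX, Finset.mul_sum]
        apply Finset.sum_le_sum
        intro x _
        rcases Nat.lt_or_ge (d x) M with hxM | hxM
        swap
        · simp [hgM _ hxM]
        have h11 : ∑ y ∈ T, μ x y * |u y - u x| ^ q ≤ vMeasure μ x * (A * gradNorm μ u x ^ q) := by
          rw [hvsum x hxM, Finset.sum_mul]
          apply Finset.sum_le_sum
          intro y _
          by_cases hμ : μ x y = 0
          · simp [hμ]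
          apply mul_le_mul_of_nonneg_left _ (hnonneg x y)
          rw [hA, ← Real.mul_rpow (Real.sqrt_nonneg _) (hgr0 x)]
          exact Real.rpow_le_rpow (abs_nonneg _) (hgr x y (hsupp x y hμ)) hq.le
        have h12 : 0 ≤ (k ^ p / (2 * A)) * (g (d x) * max (k - u x) 0) := by
          have := hg0 (d x)
          have := hf0 x
          positivity
        refine (mul_le_mul_of_nonneg_left h11 h12).trans (le_of_eq ?_)
        field_simp
      · exact mul_le_mul_of_nonneg_left hcap (by positivity)
    have hXle : k ^ p / 2 * X ≤ D * k * ε := by linarith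
    have hx0T : x0 ∈ T := by
      rw [hT]
      by_contra hcon
      have e1 := hM (d x0) (by omega)
      have e2 := h1 (d x0) le_rfl
      linarith
    have hXge : vMeasure μ x0 * gradNorm μ u x0 ^ q ≤ X := by
      have e3 := Finset.single_le_sum (f := fun x => g (d x) * max (k - u x) 0 *
        (vMeasure μ x * gradNorm μ u x ^ q))
        (fun x _ => mul_nonneg (mul_nonneg (hg0 _) (hf0 x)) (mul_nonneg (hvm0 x) (hgq0 x))) hx0T
      have e4 : g (d x0) = 1 := by
        rw [hg]
        show h (d x0) ^ σ = 1
        rw [h1 (d x0) le_rfl, Real.one_rpow]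
      have e5 : max (k - u x0) 0 = 1 := by
        rw [hk]; simp
      rw [← hX] at e3
      simp only [e4, e5, one_mul] at e3
      exact e3
    have := mul_le_mul_of_nonneg_left hXge (by positivity : 0 ≤ k ^ p / 2)
    linarith
  have hQ : 0 < vMeasure μ x0 * gradNorm μ u x0 ^ q * (k ^ p / 2) := by positivity
  have hDk : 0 < D * k := by positivity
  have := hkey (vMeasure μ x0 * gradNorm μ u x0 ^ q * (k ^ p / 2) / (2 * (D * k))) (by positivity)
  have e : D * k * (vMeasure μ x0 * gradNorm μ u x0 ^ q * (k ^ p / 2) / (2 * (D * k))) =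
    (vMeasure μ x0 * gradNorm μ u x0 ^ q * (k ^ p / 2)) / 2 := by
    field_simp
  rw [e] at this
  linarith
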